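/- Let τ = 162534 and Γ = {τ}. Then U_{Γ,1}(y) = −y, and for all n ≥ 2, U_{Γ,n}(y) = (1−y)·U_{Γ,n−1}(y) − Σ_{k=1}^{⌊n/6⌋} y^{3k−1}·binom(n−3k−1, 3k−1)·U_{Γ,n−6k+1}(y) + Σ_{k=1}^{⌊(n−2)/6⌋} y^{3k}·binom(n−3k−2, 3k)·U_{Γ,n−6k−1}(y). -/

import Mathlib

open Polynomial

/-- The reduction of a list of distinct integers: replace the i-th smallest entry by i. -/
def redL (l : List ℕ) : List ℕ :=
  l.map (fun x => (l.countP (fun y => decide (y < x))) + 1)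

/-- The number of descents of a list. -/
def desL (l : List ℕ) : ℕ :=
  (l.zip l.tail).countP (fun p => decide (p.2 < p.1))

/-- `σ` has a `Γ`-match: some consecutive factor of length at least 2 reduces to a member of `Γ`. -/
def HasMatch (Γ : Set (List ℕ)) (l : List ℕ) : Prop :=
  ∃ i j : ℕ, 1 ≤ j ∧ i + j + 1 ≤ l.length ∧ redL ((l.drop i).take (j + 1)) ∈ Γ

open scoped Classical in
/-- The set of permutations of `{1,…,n}` (in one-line notation, as lists) with no `Γ`-match. -/
noncomputable def NMfinset (Γ : Set (List ℕ)) (n : ℕ) : Finset (List ℕ) :=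
  ((List.range' 1 n).permutations.toFinset).filter (fun l => ¬ HasMatch Γ l)

/-- `NM_{Γ,n}(y) = Σ_{σ ∈ NM_n(Γ)} y^{1+des(σ)}` for `n ≥ 1`, and `NM_{Γ,0}(y) = 1`. -/
noncomputable def NMpoly (Γ : Set (List ℕ)) (n : ℕ) : Polynomial ℚ :=
  if n = 0 then 1 else ∑ l ∈ NMfinset Γ n, X ^ (1 + desL l)


/-- The list starts with an occurrence of 162534. -/
def Tau : List ℕ → Prop
  | a :: b :: c :: d :: e :: f :: _ => a < c ∧ c < e ∧ e < f ∧ f < d ∧ d < b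
  | _ => False

/-- The list avoids 162534. -/
def Av : List ℕ → Prop
  | [] => True
  | a :: l => ¬ Tau (a :: l) ∧ Av l

/-- The first `2k` entries form a nested zigzag. -/
def Zig : ℕ → List ℕ → Prop
  | 0, _ => False
  | 1, a :: b :: _ => a < b
  | (k + 2), a :: b :: c :: d :: l => a < c ∧ d < b ∧ Zig (k + 1) (c :: d :: l)
  | _, _ => False

lemma desL_nil : desL [] = 0 := rfl
lemma desL_single (a : ℕ) : desL [a] = 0 := rfl
lemma desL_cons (a b : ℕ) (l : List ℕ) :
    desL (a :: b :: l) = (if b < a then 1 else 0) + desL (b :: l) := by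
  simp [desL, List.countP_cons, add_comm]

lemma av_iff (l : List ℕ) : Av l ↔ ∀ i, ¬ Tau (l.drop i) := by
  induction l with
  | nil => simp [Av, Tau]
  | cons a l ih =>
    rw [Av, ih]
    constructor
    · rintro ⟨h1, h2⟩ i
      cases i with
      | zero => simpa using h1
      | succ i => simpa using h2 i
    · intro h
      exact ⟨by simpa using h 0, fun i => by simpa using h (i + 1)⟩

lemma redL_lt {l : List ℕ} {x y : ℕ}
    (h : l.countP (fun z => decide (z < x)) + 1 < l.countP (fun z => decide (z < y)) + 1) : x < y := by
  by_contra hc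
  have : l.countP (fun z => decide (z < y)) ≤ l.countP (fun z => decide (z < x)) := by
    apply List.countP_mono_left
    intro z _ hz
    simp only [decide_eq_true_eq] at hz ⊢
    omega
  omega

lemma redL_six (a b c d e f : ℕ) : redL [a, b, c, d, e, f] = [1, 6, 2, 5, 3, 4] ↔
    (a < c ∧ c < e ∧ e < f ∧ f < d ∧ d < b) := by
  constructor
  · intro h
    unfold redL at h
    simp only [List.map_cons, List.map_nil, List.cons.injEq, and_true] at h
    obtain ⟨h1, h2, h3, h4, h5, h6⟩ := h
    refine ⟨?_, ?_, ?_, ?_, ?_⟩ <;> apply redL_lt (l := [a, b, c, d, e, f]) <;> omega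
  · rintro ⟨h1, h2, h3, h4, h5⟩
    unfold redL
    simp only [List.map_cons, List.map_nil, List.countP_cons, List.countP_nil, decide_eq_true_eq,
      List.cons.injEq, and_true]
    refine ⟨?_, ?_, ?_, ?_, ?_, ?_⟩ <;> (split_ifs <;> omega)

lemma hasMatch_iff (l : List ℕ) : ¬ HasMatch {[1, 6, 2, 5, 3, 4]} l ↔ Av l := by
  rw [av_iff, HasMatch]
  push Not
  constructor
  · intro h i hT
    have hT' := hT
    rcases hd : l.drop i with _ | ⟨a, _ | ⟨b, _ | ⟨c, _ | ⟨d, _ | ⟨e, _ | ⟨f, t⟩⟩⟩⟩⟩⟩ <;>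
      rw [hd] at hT <;> simp only [Tau] at hT
    have hlen := congrArg List.length hd
    simp only [List.length_drop, List.length_cons] at hlen
    apply h i 5 (by norm_num) (by omega)
    rw [hd]
    simp only [Set.mem_singleton_iff, List.take_succ_cons, List.take_zero]
    exact (redL_six _ _ _ _ _ _).2 hT
  · intro h i j hj hij hm
    apply h i
    rw [Set.mem_singleton_iff] at hm
    have hlen := congrArg List.length hm
    simp only [redL, List.length_map, List.length_take, List.length_drop, List.length_cons,
      List.length_nil] at hlen
    have hj5 : j = 5 := by omega
    subst hj5
    have hl2 : 6 ≤ (l.drop i).length := by rw [List.length_drop]; omega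
    rcases hd : l.drop i with _ | ⟨a, _ | ⟨b, _ | ⟨c, _ | ⟨d, _ | ⟨e, _ | ⟨f, t⟩⟩⟩⟩⟩⟩ <;>
      rw [hd] at hl2 <;> simp only [List.length_cons, List.length_nil] at hl2 <;> try omega
    rw [hd] at hm
    simp only [List.take_succ_cons, List.take_zero] at hm
    exact (redL_six _ _ _ _ _ _).1 hm

open scoped Classical in
/-- weight of a list -/
noncomputable def wt (l : List ℕ) : ℚ[X] :=
  if l = [] then 1 else if Av l then X ^ (1 + desL l) else 0

lemma tau_append (a m : ℕ) (α β : List ℕ) (hα : m < a) :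
    Tau (a :: (α ++ m :: β)) ↔ Tau (a :: α) := by
  rcases α with _ | ⟨b, _ | ⟨c, _ | ⟨d, _ | ⟨e, _ | ⟨f, t⟩⟩⟩⟩⟩
  · rcases β with _ | ⟨b', _ | ⟨c', _ | ⟨d', _ | ⟨e', t'⟩⟩⟩⟩ <;> simp [Tau] <;> omega
  · rcases β with _ | ⟨b', _ | ⟨c', _ | ⟨d', t'⟩⟩⟩ <;> simp [Tau] <;> omega
  · rcases β with _ | ⟨b', _ | ⟨c', t'⟩⟩ <;> simp [Tau] <;> omega
  · rcases β with _ | ⟨b', t'⟩ <;> simp [Tau] <;> omega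
  · simp [Tau]; omega
  · simp [Tau]

lemma av_append (m : ℕ) (α β : List ℕ) (hα : ∀ x ∈ α, m < x) :
    Av (α ++ m :: β) ↔ Av α ∧ Av (m :: β) := by
  induction α with
  | nil => simp [Av]
  | cons a α ih =>
    rw [List.cons_append, Av, Av, tau_append a m α β (hα a (by simp)),
      ih (fun x hx => hα x (by simp [hx]))]
    tauto

lemma des_append (a m : ℕ) (α β : List ℕ) (hα : ∀ x ∈ a :: α, m < x) :
    desL ((a :: α) ++ m :: β) = desL (a :: α) + 1 + desL (m :: β) := by
  induction α generalizing a with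
  | nil => simp [desL_cons, desL_single, hα a (by simp)]
  | cons b α ih =>
    have := ih b (fun x hx => hα x (by simp at hx ⊢; tauto))
    simp only [List.cons_append] at this ⊢
    rw [desL_cons, this, desL_cons]; ring

lemma wt_append (m : ℕ) (α β : List ℕ) (hα : ∀ x ∈ α, m < x) :
    wt (α ++ m :: β) = wt α * wt (m :: β) := by
  rcases α with _ | ⟨a, α⟩
  · simp [wt]
  · have h1 := av_append m (a :: α) β hα
    have h2 := des_append a m α β hα
    rw [List.cons_append] at h1 h2
    simp only [wt, List.cons_append, reduceCtorEq, if_false]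
    rw [h2]
    split_ifs <;> first | (exfalso; tauto) | ring

lemma zig_split (i j : ℕ) (l : List ℕ) :
    Zig (j + 1 + i) l ↔ Zig (j + 1) l ∧ Zig (i + 1) (l.drop (2 * j)) := by
  induction j generalizing l with
  | zero =>
    rcases i with _ | i
    · simp
    · rcases l with _ | ⟨a, _ | ⟨b, _ | ⟨c, _ | ⟨d, t⟩⟩⟩⟩ <;>
        rw [show 0 + 1 + (i + 1) = i + 2 by ring] <;> simp [Zig]
      rintro h1 h2 h3
      have : ∀ k (c d : ℕ) (t : List ℕ), Zig (k + 1) (c :: d :: t) → c < d := by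
        intro k
        induction k with
        | zero => intro c d t h; simpa [Zig] using h
        | succ k ih =>
          intro c d t h
          rcases t with _ | ⟨e, _ | ⟨f, t⟩⟩ <;> simp [Zig] at h
          have := ih _ _ _ h.2.2
          omega
      have := this _ _ _ _ h3
      omega
  | succ j ih =>
    rcases l with _ | ⟨a, _ | ⟨b, _ | ⟨c, _ | ⟨d, t⟩⟩⟩⟩
    · simp [Zig, show j + 1 + 1 + i = (j + i) + 2 by ring]
    · simp [Zig, show j + 1 + 1 + i = (j + i) + 2 by ring]
    · simp [Zig, show j + 1 + 1 + i = (j + i) + 2 by ring]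
    · simp [Zig, show j + 1 + 1 + i = (j + i) + 2 by ring]
    · have := ih (c :: d :: t)
      rw [show j + 1 + i = j + i + 1 by ring] at this
      rw [show j + 1 + 1 + i = (j + i) + 2 by ring, Zig, this,
        show 2 * (j + 1) = 2 * j + 1 + 1 by ring, Zig]
      simp only [List.drop_succ_cons]
      tauto

open scoped Classical in
lemma zig_base (r : List ℕ) :
    (if Zig 3 r ∧ Av (r.drop 5) then (1 : ℚ[X]) else 0) =
      (if Zig 3 r ∧ Av (r.drop 1) then 1 else 0) + (if Zig 4 r ∧ Av (r.drop 3) then 1 else 0) +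
      (if Zig 5 r ∧ Av (r.drop 5) then 1 else 0) := by
  rcases r with _ | ⟨a, _ | ⟨b, _ | ⟨c, _ | ⟨d, _ | ⟨e, _ | ⟨f, t⟩⟩⟩⟩⟩⟩
  iterate 6 simp [Zig]
  by_cases h3 : Zig 3 (a :: b :: c :: d :: e :: f :: t)
  swap
  · have h4 : ¬ Zig 4 (a :: b :: c :: d :: e :: f :: t) := by
      have := zig_split 1 2 (a :: b :: c :: d :: e :: f :: t)
      simp only [show 2 + 1 + 1 = 4 from rfl, show 2 + 1 = 3 from rfl] at this
      tauto
    have h5 : ¬ Zig 5 (a :: b :: c :: d :: e :: f :: t) := by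
      have := zig_split 2 2 (a :: b :: c :: d :: e :: f :: t)
      simp only [show 2 + 1 + 2 = 5 from rfl, show 2 + 1 = 3 from rfl] at this
      tauto
    simp [h3, h4, h5]
  have h3' := h3
  simp only [Zig] at h3'
  by_cases hA : Av (f :: t)
  swap
  · simp only [List.drop_succ_cons, List.drop_zero, hA]
    rw [Av, Av, Av, Av]
    simp [hA]
  rcases t with _ | ⟨g, _ | ⟨h, _ | ⟨i, _ | ⟨j, t⟩⟩⟩⟩
  · simp [Zig, Av, Tau]
  · simp only [List.drop_succ_cons, List.drop_zero, h3, hA]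
    simp [Zig, Av, Tau]; omega
  · have n1 : ¬ Tau [b, c, d, e, f, g, h] := by simp [Tau]; omega
    simp only [List.drop_succ_cons, List.drop_zero, h3, hA]
    simp only [Av, n1]
    simp [Zig, Tau]
    split_ifs <;> first | rfl | (exfalso; omega) | simp
  · have n1 : ¬ Tau [b, c, d, e, f, g, h, i] := by simp [Tau]; omega
    have n2 : ¬ Tau [d, e, f, g, h, i] := by simp [Tau]; omega
    simp only [List.drop_succ_cons, List.drop_zero, h3, hA]
    simp only [Av] at hA
    simp only [Av, n1, n2]
    simp [Zig, Tau]
    split_ifs <;> first | rfl | (exfalso; omega) | simp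
  · have n1 : ¬ Tau (b :: c :: d :: e :: f :: g :: h :: i :: j :: t) := by simp [Tau]; omega
    have n2 : ¬ Tau (d :: e :: f :: g :: h :: i :: j :: t) := by simp [Tau]; omega
    have m1 : Tau (c :: d :: e :: f :: g :: h :: i :: j :: t) ↔
      Zig 4 (a :: b :: c :: d :: e :: f :: g :: h :: i :: j :: t) := by
      simp [Tau, Zig]; omega
    have m2 : Tau (e :: f :: g :: h :: i :: j :: t) ↔
      Zig 5 (a :: b :: c :: d :: e :: f :: g :: h :: i :: j :: t) := by
      simp [Tau, Zig]; omega
    simp only [List.drop_succ_cons, List.drop_zero, h3, hA]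
    rw [Av, Av, Av, Av]
    rw [m1, m2]
    simp only [n1, n2, hA]
    by_cases h4 : Zig 4 (a :: b :: c :: d :: e :: f :: g :: h :: i :: j :: t) <;>
    by_cases h5 : Zig 5 (a :: b :: c :: d :: e :: f :: g :: h :: i :: j :: t) <;>
    simp [h4, h5]

open scoped Classical in
lemma zig_rec (j : ℕ) (l : List ℕ) :
    (if Zig (j + 3) l ∧ Av (l.drop (2 * j + 5)) then (1 : ℚ[X]) else 0) =
      (if Zig (j + 3) l ∧ Av (l.drop (2 * j + 1)) then 1 else 0)
      + (if Zig (j + 4) l ∧ Av (l.drop (2 * j + 3)) then 1 else 0) +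
      (if Zig (j + 5) l ∧ Av (l.drop (2 * j + 5)) then 1 else 0) := by
  have h := zig_base (l.drop (2 * j))
  have h3 := zig_split 2 j l
  have h4 := zig_split 3 j l
  have h5 := zig_split 4 j l
  rw [show j + 1 + 2 = j + 3 by ring] at h3
  rw [show j + 1 + 3 = j + 4 by ring] at h4
  rw [show j + 1 + 4 = j + 5 by ring] at h5
  rw [h3, h4, h5]
  simp only [List.drop_drop] at h
  by_cases hz : Zig (j + 1) l
  · simpa [hz] using h
  · simp [hz]

lemma zig_des (k m x : ℕ) (p γ : List ℕ) (hp : p.length = 2 * k)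
    (hz : Zig (k + 1) (m :: (p ++ x :: γ))) :
    desL (m :: (p ++ x :: γ)) = k + desL (x :: γ) := by
  induction k generalizing m p with
  | zero =>
    have : p = [] := List.length_eq_zero_iff.1 (by simpa using hp)
    subst this
    simp [Zig] at hz
    simp [desL_cons, hz.le]
  | succ k ih =>
    rcases p with _ | ⟨b, _ | ⟨c, p⟩⟩
    · simp at hp
    · simp at hp; omega
    · simp only [List.cons_append, List.length_cons] at *
      have hz' : m < c ∧ c < b ∧ Zig (k + 1) (c :: (p ++ x :: γ)) := by
        have hs := zig_split 0 k (c :: (p ++ x :: γ))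
        rcases p with _ | ⟨d, p⟩
        · simp only [List.nil_append] at *
          rcases γ with _ | ⟨d, γ⟩ <;> simp only [Zig] at hz
          all_goals
            have : k = 0 := by simp at hp; omega
            subst this
            simp [Zig] at *
            omega
        · simp only [List.cons_append] at *
          simp only [Zig] at hz
          refine ⟨hz.1, ?_, hz.2.2⟩
          have := (zig_split k 0 (c :: d :: (p ++ x :: γ))).1 (by simpa [add_comm] using hz.2.2)
          have := this.1
          simp [Zig] at this
          omega
      have h1 := ih c p (by omega) hz'.2.2
      rw [desL_cons, desL_cons, h1, if_neg (by omega), if_pos hz'.2.1]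
      ring

lemma zig_trunc (k m x : ℕ) (p γ : List ℕ) (hp : p.length = 2 * k) :
    Zig (k + 1) (m :: (p ++ x :: γ)) ↔ Zig (k + 1) (m :: (p ++ [x])) := by
  induction k generalizing m p with
  | zero =>
    have : p = [] := List.length_eq_zero_iff.1 (by simpa using hp)
    subst this
    simp [Zig]
  | succ k ih =>
    rcases p with _ | ⟨b, _ | ⟨c, p⟩⟩
    · simp at hp
    · simp at hp; omega
    · simp only [List.cons_append, List.length_cons] at *
      have h1 := ih c p (by omega)
      rcases p with _ | ⟨d, p⟩
      · simp only [List.nil_append] at *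
        simp only [Zig, h1]
      · simp only [List.cons_append] at *
        simp only [Zig, h1]

lemma zig_length (k : ℕ) (l : List ℕ) (h : Zig (k + 1) l) : 2 * k + 2 ≤ l.length := by
  induction k generalizing l with
  | zero =>
    rcases l with _ | ⟨a, _ | ⟨b, t⟩⟩ <;> simp [Zig] at h
    simp
  | succ k ih =>
    rcases l with _ | ⟨a, _ | ⟨b, _ | ⟨c, _ | ⟨d, t⟩⟩⟩⟩ <;> simp [Zig] at h
    have := ih _ h.2.2
    simp at this ⊢
    omega

/-- Arrangements of a finite set as lists. -/
def LS (S : Finset ℕ) : Finset (List ℕ) :=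
  (S.sort (· ≤ ·)).permutations.toFinset

lemma mem_LS {S : Finset ℕ} {l : List ℕ} : l ∈ LS S ↔ l.Nodup ∧ l.toFinset = S := by
  rw [LS, List.mem_toFinset, List.mem_permutations]
  constructor
  · intro h
    refine ⟨h.nodup_iff.2 (Finset.sort_nodup _ _), ?_⟩
    rw [List.toFinset_eq_of_perm _ _ h, Finset.sort_toFinset]
  · rintro ⟨h, rfl⟩
    apply List.perm_of_nodup_nodup_toFinset_eq h (Finset.sort_nodup _ _)
    rw [Finset.sort_toFinset]

lemma mem_of_LS {S : Finset ℕ} {l : List ℕ} (h : l ∈ LS S) (x : ℕ) : x ∈ l ↔ x ∈ S := by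
  rw [← (mem_LS.1 h).2, List.mem_toFinset]

lemma length_of_LS {S : Finset ℕ} {l : List ℕ} (h : l ∈ LS S) : l.length = S.card := by
  rw [← (mem_LS.1 h).2, List.toFinset_card_of_nodup (mem_LS.1 h).1]

lemma LS_empty : LS ∅ = {[]} := by
  ext l
  rw [mem_LS, Finset.mem_singleton]
  constructor
  · rintro ⟨_, h⟩; simpa using h
  · rintro rfl; simp

/-- Subset convolution. -/
noncomputable def conv (f g : Finset ℕ → ℚ[X]) (S : Finset ℕ) : ℚ[X] :=
  ∑ A ∈ S.powerset, f A * g (S \ A)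

noncomputable def delta (S : Finset ℕ) : ℚ[X] := if S = ∅ then 1 else 0

lemma conv_congr {f f' g g' : Finset ℕ → ℚ[X]} {S : Finset ℕ}
    (hf : ∀ A ⊆ S, f A = f' A) (hg : ∀ A ⊆ S, g A = g' A) : conv f g S = conv f' g' S := by
  apply Finset.sum_congr rfl
  intro A hA
  rw [hf A (Finset.mem_powerset.1 hA), hg _ Finset.sdiff_subset]

lemma conv_assoc (f g h : Finset ℕ → ℚ[X]) (S : Finset ℕ) :
    conv (conv f g) h S = conv f (conv g h) S := by
  simp only [conv, Finset.sum_mul, Finset.mul_sum]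
  rw [Finset.sum_sigma', Finset.sum_sigma']
  refine Finset.sum_bij' (fun p _ => ⟨p.2, p.1 \ p.2⟩) (fun p _ => ⟨p.1 ∪ p.2, p.1⟩) ?_ ?_ ?_ ?_ ?_
  · rintro ⟨A, B⟩ hp
    simp only [Finset.mem_sigma, Finset.mem_powerset] at hp ⊢
    exact ⟨hp.2.trans hp.1, Finset.sdiff_subset_sdiff hp.1 le_rfl⟩
  · rintro ⟨A, B⟩ hp
    simp only [Finset.mem_sigma, Finset.mem_powerset] at hp ⊢
    exact ⟨Finset.union_subset hp.1 (hp.2.trans Finset.sdiff_subset), Finset.subset_union_left⟩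
  · rintro ⟨A, B⟩ hp
    simp only [Finset.mem_sigma, Finset.mem_powerset] at hp ⊢
    simp [Finset.union_sdiff_of_subset hp.2]
  · rintro ⟨A, B⟩ hp
    simp only [Finset.mem_sigma, Finset.mem_powerset] at hp ⊢
    congr 1
    ext x
    have := @hp.2 x
    simp only [Finset.mem_sdiff, Finset.mem_union] at *
    tauto
  · rintro ⟨A, B⟩ hp
    simp only [Finset.mem_sigma, Finset.mem_powerset] at hp ⊢
    rw [mul_assoc]
    congr 3
    ext x
    have := @hp.2 x
    simp only [Finset.mem_sdiff]
    tauto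

lemma conv_comm (f g : Finset ℕ → ℚ[X]) (S : Finset ℕ) : conv f g S = conv g f S := by
  refine Finset.sum_bij' (fun A _ => S \ A) (fun A _ => S \ A) ?_ ?_ ?_ ?_ ?_
  · intro A hA; simp
  · intro A hA; simp
  · intro A hA; simpa using hA
  · intro A hA; simpa using hA
  · intro A hA
    rw [Finset.sdiff_sdiff_eq_self (Finset.mem_powerset.1 hA), mul_comm]

lemma delta_conv (g : Finset ℕ → ℚ[X]) (S : Finset ℕ) : conv delta g S = g S := by
  rw [conv, Finset.sum_eq_single ∅]
  · simp [delta]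
  · intro A _ hA; simp [delta, hA]
  · simp

lemma conv_insert (f g : Finset ℕ → ℚ[X]) (S : Finset ℕ) (m : ℕ) (hm : m ∉ S) :
    conv f g (insert m S) = conv (fun A => f (insert m A)) g S +
      conv f (fun A => g (insert m A)) S := by
  rw [conv, Finset.sum_powerset_insert hm, add_comm]
  congr 1
  · apply Finset.sum_congr rfl
    intro A hA
    congr 2
    ext x
    simp only [Finset.mem_sdiff, Finset.mem_insert]
    constructor
    · tauto
    · rintro ⟨h1, h2⟩
      refine ⟨Or.inr h1, ?_⟩
      rintro (rfl | h)
      · exact hm h1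
      · exact h2 h
  · apply Finset.sum_congr rfl
    intro A hA
    congr 2
    rw [Finset.insert_sdiff_of_notMem]
    exact fun h => hm (Finset.mem_powerset.1 hA h)

lemma sum_LS_insert (S : Finset ℕ) (m : ℕ) (hm : m ∉ S) (f : List ℕ → ℚ[X]) :
    ∑ l ∈ LS (insert m S), f l =
      ∑ A ∈ S.powerset, ∑ α ∈ LS A, ∑ β ∈ LS (S \ A), f (α ++ m :: β) := by
  simp only [← Finset.sum_product' (f := fun α β => f (α ++ m :: β))]
  rw [Finset.sum_sigma']
  symm
  refine Finset.sum_bij (fun p _ => p.2.1 ++ m :: p.2.2) ?_ ?_ ?_ ?_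
  · rintro ⟨A, α, β⟩ hp
    simp only [Finset.mem_sigma, Finset.mem_powerset, Finset.mem_product, mem_LS] at hp ⊢
    obtain ⟨hA, ⟨ha, rfl⟩, hb, hb'⟩ := hp
    have hx : ∀ x, x ∈ β ↔ x ∈ S ∧ x ∉ α := by
      intro x; rw [← List.mem_toFinset, hb']; simp
    constructor
    · rw [List.nodup_append, List.nodup_cons]
      refine ⟨ha, ⟨fun h => hm ((hx m).1 h).1, hb⟩, ?_⟩
      rintro x hxa y hy rfl
      rcases List.mem_cons.1 hy with rfl | h
      · exact hm (hA (by simpa using hxa))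
      · exact ((hx _).1 h).2 hxa
    · ext x
      have := @hA x
      simp only [List.mem_toFinset, List.mem_append, List.mem_cons, Finset.mem_insert, hx] at *
      tauto
  · rintro ⟨A, α, β⟩ hp ⟨A', α', β'⟩ hp' h
    simp only [Finset.mem_sigma, Finset.mem_powerset, Finset.mem_product, mem_LS] at hp hp' h
    obtain ⟨hA, ⟨ha, rfl⟩, hb, hb'⟩ := hp
    obtain ⟨hA', ⟨ha', rfl⟩, hbb, hbb'⟩ := hp'
    have h1 : m ∉ α := fun h => hm (hA (by simpa using h))
    have h2 : m ∉ α' := fun h => hm (hA' (by simpa using h))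
    have h3 : m ∉ β := fun h => hm (by
      have : m ∈ β.toFinset := by simpa using h
      rw [hb'] at this
      exact (Finset.mem_sdiff.1 this).1)
    have h4 : α = α' ∧ β = β' := by
      have := (List.append_cons_inj_of_notMem h1 h3).1 h
      tauto
    obtain ⟨rfl, rfl⟩ := h4
    rfl
  · intro l hl
    have hml : m ∈ l := (mem_of_LS hl m).2 (by simp)
    obtain ⟨α, β, rfl⟩ := List.append_of_mem hml
    obtain ⟨h1, h2⟩ := mem_LS.1 hl
    rw [List.nodup_append, List.nodup_cons] at h1
    obtain ⟨ha, ⟨hmb, hb⟩, hab⟩ := h1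
    have hma : m ∉ α := fun h => hab m h m (by simp) rfl
    have hx : ∀ x, (x ∈ α ∨ x = m ∨ x ∈ β) ↔ (x = m ∨ x ∈ S) := by
      intro x
      rw [Finset.ext_iff] at h2
      have := h2 x
      simp only [List.mem_toFinset, List.mem_append, List.mem_cons, Finset.mem_insert] at this
      exact this
    refine ⟨⟨α.toFinset, α, β⟩, ?_, rfl⟩
    simp only [Finset.mem_sigma, Finset.mem_powerset, Finset.mem_product, mem_LS]
    refine ⟨?_, ⟨ha, trivial⟩, hb, ?_⟩
    · intro x h
      have h : x ∈ α := by simpa using h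
      rcases (hx x).1 (Or.inl h) with rfl | h'
      · exact absurd h hma
      · exact h'
    · ext x
      simp only [List.mem_toFinset, Finset.mem_sdiff]
      constructor
      · intro h
        refine ⟨?_, fun h' => hab x h' x (by simp [h]) rfl⟩
        rcases (hx x).1 (Or.inr (Or.inr h)) with rfl | h'
        · exact absurd h hmb
        · exact h'
      · rintro ⟨h, h'⟩
        rcases (hx x).2 (Or.inr h) with h1 | rfl | h1
        · exact absurd h1 h'
        · exact absurd h hm
        · exact h1
  · intros; rfl

lemma sum_LS_prefix (B : Finset ℕ) (r : ℕ) (hr : r ≤ B.card) (f : List ℕ → ℚ[X]) :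
    ∑ l ∈ LS B, f l =
      ∑ C ∈ B.powerset, ∑ p ∈ LS C, ∑ γ ∈ LS (B \ C), if p.length = r then f (p ++ γ) else 0 := by
  have : ∀ C ∈ B.powerset, (∑ p ∈ LS C, ∑ γ ∈ LS (B \ C), if p.length = r then f (p ++ γ) else 0)
      = if C.card = r then ∑ p ∈ LS C, ∑ γ ∈ LS (B \ C), f (p ++ γ) else 0 := by
    intro C _
    split_ifs with h
    · apply Finset.sum_congr rfl
      intro p hp
      simp [length_of_LS hp, h]
    · apply Finset.sum_eq_zero
      intro p hp
      simp [length_of_LS hp, h]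
  rw [Finset.sum_congr rfl this, ← Finset.sum_filter]
  simp only [← Finset.sum_product' (f := fun α β => f (α ++ β))]
  rw [Finset.sum_sigma']
  refine Finset.sum_bij' (fun l _ => ⟨(l.take r).toFinset, l.take r, l.drop r⟩)
    (fun p _ => p.2.1 ++ p.2.2) ?_ ?_ ?_ ?_ ?_
  · intro l hl
    have hlen := length_of_LS hl
    obtain ⟨h1, rfl⟩ := mem_LS.1 hl
    have h1' := h1
    rw [← List.take_append_drop r l, List.nodup_append] at h1'
    obtain ⟨ha, hb, hab⟩ := h1'
    have hx : ∀ x, x ∈ l ↔ x ∈ l.take r ∨ x ∈ l.drop r := by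
      intro x; rw [← List.mem_append, List.take_append_drop]
    simp only [Finset.mem_sigma, Finset.mem_filter, Finset.mem_powerset, Finset.mem_product, mem_LS]
    refine ⟨⟨?_, ?_⟩, ⟨ha, trivial⟩, hb, ?_⟩
    · intro x; simp only [List.mem_toFinset, hx]; tauto
    · rw [List.toFinset_card_of_nodup ha, List.length_take]; omega
    · ext x
      have := hab x
      simp only [Finset.mem_sdiff, List.mem_toFinset, hx]
      constructor
      · intro h; exact ⟨Or.inr h, fun h' => this h' x h rfl⟩
      · tauto
  · rintro ⟨C, p, γ⟩ h
    simp only [Finset.mem_sigma, Finset.mem_filter, Finset.mem_powerset, Finset.mem_product, mem_LS] at h ⊢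
    obtain ⟨⟨hC, hr⟩, ⟨ha, rfl⟩, hb, hb'⟩ := h
    have hx : ∀ x, x ∈ γ ↔ x ∈ B ∧ x ∉ p := by
      intro x; rw [← List.mem_toFinset, hb']; simp
    constructor
    · rw [List.nodup_append]
      refine ⟨ha, hb, ?_⟩
      rintro x h y hy rfl
      exact ((hx x).1 hy).2 h
    · ext x
      have := @hC x
      simp only [List.mem_toFinset, List.mem_append, hx] at *
      tauto
  · intro l hl; simp
  · rintro ⟨C, p, γ⟩ h
    simp only [Finset.mem_sigma, Finset.mem_filter, Finset.mem_powerset, Finset.mem_product, mem_LS] at h ⊢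
    obtain ⟨⟨hC, hr⟩, ⟨ha, rfl⟩, hb, hb'⟩ := h
    rw [List.toFinset_card_of_nodup ha] at hr
    subst hr
    simp
  · intro l hl; simp

noncomputable def Nf (S : Finset ℕ) : ℚ[X] := ∑ l ∈ LS S, wt l

noncomputable def Nh (s : ℕ) (S : Finset ℕ) : ℚ[X] :=
  ∑ l ∈ LS S, if l.head? = some s then wt l else 0

noncomputable def qf (m : ℕ) (S : Finset ℕ) : ℚ[X] := ∑ l ∈ LS S, wt (m :: l)

lemma notMem_of_lt {m : ℕ} {S : Finset ℕ} (hm : ∀ x ∈ S, m < x) : m ∉ S :=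
  fun h => lt_irrefl _ (hm m h)

lemma Nf_insert (m : ℕ) (S : Finset ℕ) (hm : ∀ x ∈ S, m < x) :
    Nf (insert m S) = conv Nf (qf m) S := by
  rw [Nf, sum_LS_insert _ _ (notMem_of_lt hm), conv]
  apply Finset.sum_congr rfl
  intro A hA
  rw [Nf, qf, Finset.sum_mul]
  apply Finset.sum_congr rfl
  intro α hα
  rw [Finset.mul_sum]
  apply Finset.sum_congr rfl
  intro β _
  apply wt_append
  intro x hx
  exact hm x (Finset.mem_powerset.1 hA ((mem_of_LS hα x).1 hx))

lemma Nh_insert (s m : ℕ) (hs : s ≠ m) (S : Finset ℕ) (hm : ∀ x ∈ S, m < x) :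
    Nh s (insert m S) = conv (Nh s) (qf m) S := by
  rw [Nh, sum_LS_insert _ _ (notMem_of_lt hm), conv]
  apply Finset.sum_congr rfl
  intro A hA
  rw [Nh, qf, Finset.sum_mul]
  apply Finset.sum_congr rfl
  intro α hα
  rw [Finset.mul_sum]
  apply Finset.sum_congr rfl
  intro β _
  rw [wt_append]
  · rcases α with _ | ⟨a, α⟩
    · simp [hs.symm]
    · simp
  intro x hx
  exact hm x (Finset.mem_powerset.1 hA ((mem_of_LS hα x).1 hx))

lemma Nh_notMem (s : ℕ) (S : Finset ℕ) (hs : s ∉ S) : Nh s S = 0 := by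
  apply Finset.sum_eq_zero
  intro l hl
  rw [if_neg]
  intro h
  exact hs ((mem_of_LS hl s).1 (List.mem_of_head? h))

lemma Nh_insert_self (m : ℕ) (S : Finset ℕ) (hm : m ∉ S) :
    Nh m (insert m S) = qf m S := by
  rw [Nh, sum_LS_insert _ _ hm, Finset.sum_eq_single ∅]
  · simp [LS_empty, qf]
  · intro A hA hne
    apply Finset.sum_eq_zero
    intro α hα
    apply Finset.sum_eq_zero
    intro β _
    rw [if_neg]
    rcases α with _ | ⟨a, α⟩
    · exfalso
      have := (mem_LS.1 hα).2
      simp at this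
      exact hne this.symm
    · simp
      rintro rfl
      exact hm (Finset.mem_powerset.1 hA ((mem_of_LS hα a).1 (by simp)))
  · simp

lemma u_insert (u : Finset ℕ → ℚ[X]) (hu : ∀ S, conv Nf u S = delta S)
    (m : ℕ) (S : Finset ℕ) (hm : ∀ x ∈ S, m < x) :
    u (insert m S) = - conv (qf m) u S := by
  have key : ∀ A ⊆ S, conv (conv Nf (qf m)) u A + conv Nf (fun B => u (insert m B)) A = 0 := by
    intro A hA
    have hmA : ∀ x ∈ A, m < x := fun x hx => hm x (hA hx)
    have h := hu (insert m A)
    rw [conv_insert _ _ _ _ (notMem_of_lt hmA)] at h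
    rw [← conv_congr (f := fun B => Nf (insert m B)) (g := u) (g' := u)
      (fun B hB => Nf_insert m B (fun x hx => hmA x (hB hx))) (fun _ _ => rfl), h]
    simp [delta]
  have h2 : conv u (fun A => conv (conv Nf (qf m)) u A + conv Nf (fun B => u (insert m B)) A) S = 0 := by
    apply Finset.sum_eq_zero
    intro A _
    simp only
    rw [key _ Finset.sdiff_subset, mul_zero]
  have h3 : conv u (fun A => conv (conv Nf (qf m)) u A + conv Nf (fun B => u (insert m B)) A) S
      = conv u (conv Nf (conv (qf m) u)) S + conv u (conv Nf (fun B => u (insert m B))) S := by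
    simp only [conv_assoc]
    rw [conv, conv, conv, ← Finset.sum_add_distrib]
    simp only [mul_add]
  rw [h3, ← conv_assoc u Nf (conv (qf m) u), ← conv_assoc u Nf (fun B => u (insert m B))] at h2
  have hd : ∀ A ⊆ S, conv u Nf A = delta A := fun A _ => by rw [conv_comm, hu]
  rw [conv_congr (f' := delta) hd (fun _ _ => rfl), delta_conv,
    conv_congr (f' := delta) hd (fun _ _ => rfl), delta_conv] at h2
  linear_combination h2

lemma Nh_conv (u : Finset ℕ → ℚ[X]) (hu : ∀ S, conv Nf u S = delta S) (s : ℕ) (S : Finset ℕ) :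
    conv (Nh s) u S = if s ∈ S ∧ ∀ z ∈ S, s ≤ z then - u S else 0 := by
  rcases S.eq_empty_or_nonempty with rfl | hne
  · simp [conv, Nh, LS_empty]
  set m := S.min' hne with hmdef
  have hmS : m ∈ S := S.min'_mem hne
  obtain ⟨S', hS'⟩ : ∃ S', S' = S.erase m := ⟨_, rfl⟩
  have hm : ∀ x ∈ S', m < x := by
    intro x hx
    rw [hS', Finset.mem_erase] at hx
    exact lt_of_le_of_ne (S.min'_le x hx.2) (Ne.symm hx.1)
  have hS : S = insert m S' := by rw [hS', Finset.insert_erase hmS]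
  clear_value m
  subst hS
  rw [conv_insert _ _ _ _ (notMem_of_lt hm)]
  by_cases hs : s = m
  · subst hs
    rw [if_pos ⟨by simp, by
      intro z hz
      rcases Finset.mem_insert.1 hz with rfl | h
      · exact le_rfl
      · exact (hm z h).le⟩, u_insert u hu s S' hm]
    have h0 : conv (Nh s) (fun A => u (insert s A)) S' = 0 := by
      apply Finset.sum_eq_zero
      intro A hA
      rw [Nh_notMem, zero_mul]
      exact fun h => notMem_of_lt hm (Finset.mem_powerset.1 hA h)
    rw [h0, add_zero, neg_neg]
    apply conv_congr _ (fun _ _ => rfl)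
    intro A hA
    exact Nh_insert_self s A (fun h => notMem_of_lt hm (hA h))
  · rw [if_neg]
    · rw [conv_congr (f' := conv (Nh s) (qf m)) (g' := u) (fun A hA => Nh_insert s m hs A
        (fun x hx => hm x (hA hx))) (fun _ _ => rfl), conv_assoc]
      rw [conv_congr (f := Nh s) (f' := Nh s) (g' := fun A => - conv (qf m) u A) (fun _ _ => rfl)
        (fun A hA => u_insert u hu m A (fun x hx => hm x (hA hx)))]
      rw [conv, conv, ← Finset.sum_add_distrib]
      simp
    · rintro ⟨h1, h2⟩
      have h3 := h2 m (by simp)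
      rcases Finset.mem_insert.1 h1 with h | h
      · exact hs h
      · have := hm s h
        omega

open scoped Classical in
noncomputable def Ef (j m : ℕ) (S : Finset ℕ) : ℚ[X] :=
  ∑ l ∈ LS S, (if Zig (j + 3) (m :: l) ∧ Av ((m :: l).drop (2 * j + 1)) then 1 else 0) *
    X ^ (1 + desL (m :: l))

open scoped Classical in
noncomputable def Wf (k m : ℕ) (S : Finset ℕ) : ℚ[X] :=
  ∑ l ∈ LS S, (if Zig (k + 1) (m :: l) ∧ Av ((m :: l).drop (2 * k + 1)) then 1 else 0) *
    X ^ (1 + desL (m :: l))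

lemma Wf_eq (j m : ℕ) (S : Finset ℕ) :
    Wf (j + 2) m S = Ef j m S + Ef (j + 1) m S + Ef (j + 2) m S := by
  simp only [Wf, Ef]
  rw [← Finset.sum_add_distrib, ← Finset.sum_add_distrib]
  apply Finset.sum_congr rfl
  intro l _
  rw [← add_mul, ← add_mul]
  congr 1
  exact zig_rec j (m :: l)

lemma Ef_zero (j m : ℕ) (S : Finset ℕ) (h : S.card < 2 * j + 5) : Ef j m S = 0 := by
  apply Finset.sum_eq_zero
  intro l hl
  rw [if_neg, zero_mul]
  rintro ⟨hz, _⟩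
  have := zig_length (j + 2) _ hz
  rw [List.length_cons, length_of_LS hl] at this
  omega

lemma Ef_sum (m K : ℕ) (S : Finset ℕ) :
    Ef 0 m S = ∑ i ∈ Finset.range K, (Wf (3 * i + 2) m S - Wf (3 * i + 3) m S) + Ef (3 * K) m S := by
  induction K with
  | zero => simp
  | succ K ih =>
    rw [Finset.sum_range_succ, ih, Wf_eq, show 3 * K + 3 = (3 * K + 1) + 2 by ring, Wf_eq,
      show 3 * (K + 1) = 3 * K + 3 by ring, show 3 * K + 1 + 1 = 3 * K + 2 by ring,
      show 3 * K + 1 + 2 = 3 * K + 3 by ring]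
    ring

lemma tau_zig (l : List ℕ) : Tau l ↔ Zig 3 l := by
  rcases l with _ | ⟨a, _ | ⟨b, _ | ⟨c, _ | ⟨d, _ | ⟨e, _ | ⟨f, t⟩⟩⟩⟩⟩⟩ <;> simp [Tau, Zig]
  omega

lemma qf_eq (m : ℕ) (S : Finset ℕ) (hm : ∀ x ∈ S, m < x) :
    qf m S = (X - 1) * delta S + Nf S - Ef 0 m S := by
  rcases S.eq_empty_or_nonempty with rfl | hne
  · simp [qf, delta, Nf, Ef, LS_empty, wt, Av, Tau, desL_single, Zig]
  · rw [delta, if_neg hne.ne_empty, mul_zero, zero_add, qf, Nf, Ef, ← Finset.sum_sub_distrib]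
    apply Finset.sum_congr rfl
    intro l hl
    rcases l with _ | ⟨a, l⟩
    · exfalso
      have := length_of_LS hl
      simp at this
      exact hne.ne_empty (Finset.card_eq_zero.1 this.symm)
    · have ha : m < a := hm a ((mem_of_LS hl a).1 (by simp))
      have ht := tau_zig (m :: a :: l)
      simp only [wt, reduceCtorEq, if_false, List.drop_succ_cons, List.drop_zero,
        desL_cons m, ha.le.not_gt, Nat.mul_zero, Nat.zero_add]
      have : Av (m :: a :: l) ↔ ¬ Tau (m :: a :: l) ∧ Av (a :: l) := by rw [Av]
      by_cases h1 : Tau (m :: a :: l) <;> by_cases h2 : Av (a :: l) <;> simp [this, h1, h2, ht.symm]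

lemma u_rec (u : Finset ℕ → ℚ[X]) (hu : ∀ S, conv Nf u S = delta S)
    (m : ℕ) (S : Finset ℕ) (hm : ∀ x ∈ S, m < x) :
    u (insert m S) = (1 - X) * u S - delta S + conv (Ef 0 m) u S := by
  rw [u_insert u hu m S hm]
  have h1 : conv (qf m) u S = (X - 1) * conv delta u S + conv Nf u S - conv (Ef 0 m) u S := by
    simp only [conv]
    rw [Finset.mul_sum, ← Finset.sum_add_distrib, ← Finset.sum_sub_distrib]
    apply Finset.sum_congr rfl
    intro A hA
    rw [qf_eq m A (fun x hx => hm x (Finset.mem_powerset.1 hA hx))]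
    ring
  rw [h1, delta_conv, hu]
  ring

lemma zig_bounds (k a b : ℕ) (t : List ℕ) (ht : t.length = 2 * k) (h : Zig (k + 1) (a :: b :: t)) :
    a < b ∧ ∀ z ∈ t, a < z ∧ z < b := by
  induction k generalizing a b t with
  | zero =>
    have : t = [] := List.length_eq_zero_iff.1 (by simpa using ht)
    subst this
    simpa [Zig] using h
  | succ k ih =>
    rcases t with _ | ⟨c, _ | ⟨d, t⟩⟩
    · simp at ht
    · simp at ht; omega
    · simp only [Zig] at h
      simp only [List.length_cons] at ht
      obtain ⟨h1, h2⟩ := ih c d t (by omega) h.2.2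
      refine ⟨by omega, ?_⟩
      intro z hz
      rcases List.mem_cons.1 hz with rfl | hz
      · omega
      rcases List.mem_cons.1 hz with rfl | hz
      · omega
      have := h2 z hz
      omega

lemma zig_tail_bounds (k c x : ℕ) (p : List ℕ) (hp : p.length = 2 * k)
    (h : Zig (k + 1) (c :: (p ++ [x]))) : ∀ z ∈ p ++ [x], c < z := by
  rcases p with _ | ⟨d, p⟩
  · simp at hp
    subst hp
    simpa [Zig] using h
  · simp only [List.cons_append] at h ⊢
    have := zig_bounds k c d (p ++ [x]) (by simp at hp ⊢; omega) h
    intro z hz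
    rcases List.mem_cons.1 hz with rfl | hz
    · exact this.1
    · exact (this.2 z hz).1

lemma zig_cons (k m b c x : ℕ) (p : List ℕ) (hp : p.length = 2 * k) :
    Zig (k + 2) (m :: ((b :: c :: p) ++ [x])) ↔
      m < c ∧ (∀ z ∈ p ++ [x], c < z ∧ z < b) ∧ Zig (k + 1) (c :: (p ++ [x])) := by
  constructor
  · intro h
    have h1 := zig_bounds (k + 1) m b (c :: (p ++ [x])) (by simp; omega) h
    have h2 : Zig (k + 1) (c :: (p ++ [x])) := by
      rcases p with _ | ⟨d, p⟩ <;> simp only [List.cons_append, List.nil_append, Zig] at h ⊢ <;>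
        exact h.2.2
    have h3 := zig_tail_bounds k c x p hp h2
    refine ⟨(h1.2 c (by simp)).1, fun z hz => ⟨h3 z hz, (h1.2 z (by simp at hz ⊢; tauto)).2⟩, h2⟩
  · rintro ⟨h1, h2, h3⟩
    rcases p with _ | ⟨d, p⟩ <;> simp only [List.cons_append, List.nil_append, Zig] at h3 ⊢
    · exact ⟨h1, (h2 x (by simp)).2, h3⟩
    · exact ⟨h1, (h2 d (by simp)).2, h3⟩

lemma zig_count (k m x : ℕ) (p : List ℕ) (hp : p.length = 2 * k)
    (h : Zig (k + 1) (m :: (p ++ [x]))) :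
    p.countP (fun z => decide (z < x)) = k ∧ p.countP (fun z => decide (x < z)) = k := by
  induction k generalizing m p with
  | zero =>
    have : p = [] := List.length_eq_zero_iff.1 (by simpa using hp)
    subst this
    simp
  | succ k ih =>
    rcases p with _ | ⟨b, _ | ⟨c, p⟩⟩
    · simp at hp
    · simp at hp; omega
    · have hp' : p.length = 2 * k := by simp at hp; omega
      obtain ⟨h1, h2, h3⟩ := (zig_cons k m b c x p hp').1 h
      obtain ⟨i1, i2⟩ := ih c p hp' h3
      have hx := h2 x (by simp)
      simp only [List.countP_cons, i1, i2, decide_eq_true_eq]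
      rw [if_pos hx.1, if_neg (by omega), if_neg (by omega), if_pos hx.2]
      omega

lemma zig_unique (k m m' x : ℕ) (p p' : List ℕ) (hp : p.length = 2 * k) (hp' : p'.length = 2 * k)
    (h : Zig (k + 1) (m :: (p ++ [x]))) (h' : Zig (k + 1) (m' :: (p' ++ [x])))
    (hpp : p.Perm p') : p = p' := by
  induction k generalizing m m' p p' with
  | zero =>
    have e1 : p = [] := List.length_eq_zero_iff.1 (by simpa using hp)
    have e2 : p' = [] := List.length_eq_zero_iff.1 (by simpa using hp')
    rw [e1, e2]
  | succ k ih =>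
    rcases p with _ | ⟨b, _ | ⟨c, p⟩⟩
    · simp at hp
    · simp at hp; omega
    rcases p' with _ | ⟨b', _ | ⟨c', p'⟩⟩
    · simp at hp'
    · simp at hp'; omega
    have hp1 : p.length = 2 * k := by simp at hp; omega
    have hp1' : p'.length = 2 * k := by simp at hp'; omega
    obtain ⟨h1, h2, h3⟩ := (zig_cons k m b c x p hp1).1 h
    obtain ⟨h1', h2', h3'⟩ := (zig_cons k m' b' c' x p' hp1').1 h'
    have hx := h2 x (by simp)
    have hx' := h2' x (by simp)
    have e1 : ∀ z ∈ b :: c :: p, c ≤ z ∧ z ≤ b := by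
      intro z hz
      simp only [List.mem_cons] at hz
      rcases hz with rfl | rfl | hz
      · omega
      · omega
      · have := h2 z (by simp [hz]); omega
    have e1' : ∀ z ∈ b' :: c' :: p', c' ≤ z ∧ z ≤ b' := by
      intro z hz
      simp only [List.mem_cons] at hz
      rcases hz with rfl | rfl | hz
      · omega
      · omega
      · have := h2' z (by simp [hz]); omega
    have f1 := e1 b' (hpp.mem_iff.2 (by simp))
    have f2 := e1 c' (hpp.mem_iff.2 (by simp))
    have f3 := e1' b (hpp.mem_iff.1 (by simp))
    have f4 := e1' c (hpp.mem_iff.1 (by simp))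
    have hb : b = b' := by omega
    have hc : c = c' := by omega
    subst hb hc
    rw [ih c c p p' hp1 hp1' h3 h3' (List.Perm.cons_inv (List.Perm.cons_inv hpp))]

lemma zig_exists (k m x : ℕ) (C : Finset ℕ) (hm : ∀ z ∈ C, m < z) (hmx : m < x) (hx : x ∉ C)
    (h1 : (C.filter (· < x)).card = k) (h2 : (C.filter (x < ·)).card = k) :
    ∃ p ∈ LS C, p.length = 2 * k ∧ Zig (k + 1) (m :: (p ++ [x])) := by
  induction k generalizing m C with
  | zero =>
    have : C = ∅ := by
      rw [Finset.card_eq_zero, Finset.filter_eq_empty_iff] at h1 h2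
      apply Finset.eq_empty_of_forall_notMem
      intro z hz
      have a1 := h1 hz
      have a2 := h2 hz
      have : z = x := by omega
      exact hx (this ▸ hz)
    subst this
    exact ⟨[], by simp [LS_empty], by simp, by simpa [Zig] using hmx⟩
  | succ k ih =>
    have n1 : (C.filter (· < x)).Nonempty := by rw [← Finset.card_pos]; omega
    have n2 : (C.filter (x < ·)).Nonempty := by rw [← Finset.card_pos]; omega
    obtain ⟨c0, hc0⟩ := n1
    obtain ⟨b0, hb0⟩ := n2
    rw [Finset.mem_filter] at hc0 hb0
    have hne : C.Nonempty := ⟨c0, hc0.1⟩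
    set c := C.min' hne with hc
    set b := C.max' hne with hb
    have hcC : c ∈ C := C.min'_mem hne
    have hbC : b ∈ C := C.max'_mem hne
    have hcl : ∀ z ∈ C, c ≤ z := fun z hz => C.min'_le z hz
    have hbl : ∀ z ∈ C, z ≤ b := fun z hz => C.le_max' z hz
    clear_value b c
    have hcx : c < x := lt_of_le_of_lt (hcl _ hc0.1) hc0.2
    have hbx : x < b := lt_of_lt_of_le hb0.2 (hbl _ hb0.1)
    obtain ⟨C', hC'⟩ : ∃ C', C' = (C.erase b).erase c := ⟨_, rfl⟩
    have hmem : ∀ z, z ∈ C' ↔ z ≠ c ∧ z ≠ b ∧ z ∈ C := by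
      intro z; rw [hC', Finset.mem_erase, Finset.mem_erase]
    have hf1 : C'.filter (· < x) = (C.filter (· < x)).erase c := by
      ext z; simp only [Finset.mem_filter, hmem, Finset.mem_erase]
      constructor
      · tauto
      · rintro ⟨a1, a2, a3⟩
        exact ⟨⟨a1, by omega, a2⟩, a3⟩
    have hf2 : C'.filter (x < ·) = (C.filter (x < ·)).erase b := by
      ext z; simp only [Finset.mem_filter, hmem, Finset.mem_erase]
      constructor
      · tauto
      · rintro ⟨a1, a2, a3⟩
        exact ⟨⟨by omega, a1, a2⟩, a3⟩
    have hbd : ∀ z ∈ C', c < z ∧ z < b := by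
      intro z hz
      rw [hmem] at hz
      have := hcl z hz.2.2
      have := hbl z hz.2.2
      omega
    obtain ⟨p, hp, hpl, hpz⟩ := ih c C' (fun z hz => (hbd z hz).1) hcx
      (fun h => hx ((hmem x).1 h).2.2)
      (by rw [hf1, Finset.card_erase_of_mem (by simp [hcC, hcx]), h1]; rfl)
      (by rw [hf2, Finset.card_erase_of_mem (by simp [hbC, hbx]), h2]; rfl)
    refine ⟨b :: c :: p, ?_, by simp; omega, ?_⟩
    · have hpm := mem_of_LS hp
      rw [mem_LS] at hp ⊢
      constructor
      · rw [List.nodup_cons, List.nodup_cons]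
        refine ⟨?_, ?_, hp.1⟩
        · rw [List.mem_cons, hpm, hmem]
          rintro (h | h)
          · omega
          · exact h.2.1 rfl
        · rw [hpm, hmem]
          exact fun h => h.1 rfl
      · ext z
        rw [List.mem_toFinset, List.mem_cons, List.mem_cons, hpm, hmem]
        constructor
        · rintro (rfl | rfl | h)
          · exact hbC
          · exact hcC
          · exact h.2.2
        · tauto
    · rw [zig_cons k m b c x p hpl]
      refine ⟨hm c hcC, ?_, hpz⟩
      intro z hz
      rw [List.mem_append, List.mem_singleton] at hz
      rcases hz with hz | rfl
      · exact hbd z ((mem_of_LS hp z).1 hz)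
      · exact ⟨hcx, hbx⟩

open scoped Classical in
noncomputable def cf (k m x : ℕ) (C : Finset ℕ) : ℚ[X] :=
  ∑ p ∈ LS C, if p.length = 2 * k ∧ Zig (k + 1) (m :: (p ++ [x])) then 1 else 0

lemma filter_card_LS {C : Finset ℕ} {p : List ℕ} (hp : p ∈ LS C) (P : ℕ → Prop) [DecidablePred P] :
    (C.filter P).card = p.countP (fun z => decide (P z)) := by
  obtain ⟨h1, rfl⟩ := mem_LS.1 hp
  rw [List.countP_eq_length_filter, ← List.toFinset_card_of_nodup (h1.filter _)]
  congr 1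
  ext z
  simp

lemma cf_eq (k m x : ℕ) (C : Finset ℕ) (hm : ∀ z ∈ C, m < z) (hmx : m < x) (hx : x ∉ C) :
    cf k m x C = if (C.filter (· < x)).card = k ∧ (C.filter (x < ·)).card = k then 1 else 0 := by
  split_ifs with h
  · obtain ⟨p, hp, hpl, hpz⟩ := zig_exists k m x C hm hmx hx h.1 h.2
    rw [cf, Finset.sum_eq_single p]
    · rw [if_pos ⟨hpl, hpz⟩]
    · intro p' hp' hne
      rw [if_neg]
      rintro ⟨a1, a2⟩
      apply hne
      apply zig_unique k m m x p' p a1 hpl a2 hpz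
      apply List.perm_of_nodup_nodup_toFinset_eq (mem_LS.1 hp').1 (mem_LS.1 hp).1
      rw [(mem_LS.1 hp').2, (mem_LS.1 hp).2]
    · intro h; exact absurd hp h
  · apply Finset.sum_eq_zero
    intro p hp
    rw [if_neg]
    rintro ⟨a1, a2⟩
    apply h
    rw [filter_card_LS hp, filter_card_LS hp]
    exact zig_count k m x p a1 a2

lemma cf_card (k m x : ℕ) (C : Finset ℕ) (h : C.card ≠ 2 * k) : cf k m x C = 0 := by
  apply Finset.sum_eq_zero
  intro p hp
  rw [if_neg]
  rintro ⟨a1, _⟩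
  rw [length_of_LS hp] at a1
  exact h a1

lemma Wf_conv (k m : ℕ) (S B : Finset ℕ) (hB : B ⊆ S) :
    Wf k m B = X ^ k * ∑ x ∈ S, conv (cf k m x) (Nh x) B := by
  by_cases hc : B.card < 2 * k
  · have h1 : Wf k m B = 0 := by
      apply Finset.sum_eq_zero
      intro l hl
      rw [if_neg, zero_mul]
      rintro ⟨hz, _⟩
      have := zig_length k _ hz
      rw [List.length_cons, length_of_LS hl] at this
      omega
    rw [h1, Finset.sum_eq_zero, mul_zero]
    intro x _
    apply Finset.sum_eq_zero
    intro C hC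
    rw [cf_card, zero_mul]
    have := Finset.card_le_card (Finset.mem_powerset.1 hC)
    omega
  · rw [Wf, sum_LS_prefix B (2 * k) (by omega)]
    simp only [conv]
    rw [Finset.sum_comm (s := S), Finset.mul_sum]
    apply Finset.sum_congr rfl
    intro C hC
    simp only [cf, Nh, Finset.sum_mul_sum]
    rw [Finset.sum_comm (s := S), Finset.mul_sum]
    apply Finset.sum_congr rfl
    intro p hp
    rw [Finset.sum_comm (s := S), Finset.mul_sum]
    apply Finset.sum_congr rfl
    intro γ hγ
    by_cases hpl : p.length = 2 * k
    swap
    · simp [hpl]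
    rw [if_pos hpl]
    have hdrop : (m :: (p ++ γ)).drop (2 * k + 1) = γ := by
      rw [List.drop_succ_cons, ← hpl, List.drop_left]
    rw [hdrop]
    rcases γ with _ | ⟨x, γ⟩
    · have : ¬ Zig (k + 1) (m :: (p ++ [])) := by
        intro h
        have := zig_length k _ h
        simp at this
        omega
      rw [if_neg (by tauto)]
      simp
    · have hxS : x ∈ S := by
        apply hB
        have := (mem_of_LS hγ x).1 (by simp)
        exact (Finset.mem_sdiff.1 this).1
      rw [Finset.sum_eq_single x]
      · have ht := zig_trunc k m x p γ hpl
        by_cases hz : Zig (k + 1) (m :: (p ++ x :: γ))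
        · have hd := zig_des k m x p γ hpl hz
          have hz' := ht.1 hz
          rw [if_pos (show p.length = 2 * k ∧ Zig (k + 1) (m :: (p ++ [x])) from ⟨hpl, hz'⟩),
            if_pos (show (x :: γ).head? = some x from rfl), wt, if_neg (List.cons_ne_nil _ _), hd]
          by_cases ha : Av (x :: γ)
          · rw [if_pos (show Zig (k + 1) (m :: (p ++ x :: γ)) ∧ Av (x :: γ) from ⟨hz, ha⟩),
              if_pos ha]; ring
          · rw [if_neg (show ¬ (Zig (k + 1) (m :: (p ++ x :: γ)) ∧ Av (x :: γ)) from
              fun h => ha h.2), if_neg ha]; ring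
        · have hz' := fun h => hz (ht.2 h)
          rw [if_neg (show ¬ (Zig (k + 1) (m :: (p ++ x :: γ)) ∧ Av (x :: γ)) from fun h => hz h.1),
            if_neg (show ¬ (p.length = 2 * k ∧ Zig (k + 1) (m :: (p ++ [x]))) from
              fun h => hz' h.2)]; ring
      · intro y _ hy
        simp [hy.symm]
      · exact fun h => absurd hxS h

lemma count_C (k N : ℕ) (hk : k + 1 ≤ N) [DecidablePred (fun C : Finset ℕ => k + 1 ∉ C ∧
      (C.filter (· < k + 1)).card = k ∧
      (C.filter (k + 1 < ·)).card = k ∧ ∀ z ∈ Finset.Icc 1 N \ C, k + 1 ≤ z)] :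
    ((Finset.Icc 1 N).powerset.filter (fun C : Finset ℕ => k + 1 ∉ C ∧
      (C.filter (· < k + 1)).card = k ∧
      (C.filter (k + 1 < ·)).card = k ∧ ∀ z ∈ Finset.Icc 1 N \ C, k + 1 ≤ z)).card =
      (N - (k + 1)).choose k := by
  have h1 : (Finset.powersetCard k (Finset.Icc (k + 2) N)).card = (N - (k + 1)).choose k := by
    rw [Finset.card_powersetCard, Nat.card_Icc]
    congr 1
    omega
  rw [← h1]
  refine Finset.card_bij' (fun C _ => C.filter (k + 1 < ·)) (fun D _ => Finset.Icc 1 k ∪ D) ?_ ?_ ?_ ?_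
  · intro C hC
    simp only [Finset.mem_filter, Finset.mem_powerset, Finset.mem_powersetCard] at hC ⊢
    refine ⟨?_, hC.2.2.2.1⟩
    intro z hz
    rw [Finset.mem_filter] at hz
    have := Finset.mem_Icc.1 (hC.1 hz.1)
    rw [Finset.mem_Icc]; omega
  · intro D hD
    simp only [Finset.mem_filter, Finset.mem_powerset, Finset.mem_powersetCard] at hD ⊢
    have hD' : ∀ z ∈ D, k + 2 ≤ z ∧ z ≤ N := fun z hz => Finset.mem_Icc.1 (hD.1 hz)
    refine ⟨?_, ?_, ?_, ?_, ?_⟩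
    · intro z hz
      rw [Finset.mem_union, Finset.mem_Icc] at hz
      rw [Finset.mem_Icc]
      rcases hz with hz | hz
      · omega
      · have := hD' z hz; omega
    · rw [Finset.mem_union, Finset.mem_Icc]
      rintro (h | h)
      · omega
      · have := hD' _ h; omega
    · have : (Finset.Icc 1 k ∪ D).filter (· < k + 1) = Finset.Icc 1 k := by
        ext z
        rw [Finset.mem_filter, Finset.mem_union, Finset.mem_Icc]
        constructor
        · rintro ⟨h | h, h'⟩
          · exact h
          · have := hD' _ h; omega
        · intro h; exact ⟨Or.inl h, by omega⟩
      rw [this]; simp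
    · have : (Finset.Icc 1 k ∪ D).filter (k + 1 < ·) = D := by
        ext z
        rw [Finset.mem_filter, Finset.mem_union, Finset.mem_Icc]
        constructor
        · rintro ⟨h | h, h'⟩
          · omega
          · exact h
        · intro h
          have := hD' _ h
          exact ⟨Or.inr h, by omega⟩
      rw [this]; exact hD.2
    · intro z hz
      rw [Finset.mem_sdiff, Finset.mem_union, Finset.mem_Icc, Finset.mem_Icc] at hz
      by_contra h
      exact hz.2 (Or.inl (by omega))
  · intro C hC
    simp only [Finset.mem_filter, Finset.mem_powerset] at hC
    obtain ⟨h1, h2, h3, h4, h5⟩ := hC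
    ext z
    rw [Finset.mem_union, Finset.mem_Icc, Finset.mem_filter]
    constructor
    · rintro (h | h)
      · by_contra hz
        have := h5 z (by rw [Finset.mem_sdiff, Finset.mem_Icc]; exact ⟨by omega, hz⟩)
        omega
      · exact h.1
    · intro h
      have := Finset.mem_Icc.1 (h1 h)
      have hne : z ≠ k + 1 := by rintro rfl; exact h2 h
      by_cases hz : z ≤ k
      · left; omega
      · right; exact ⟨h, by omega⟩
  · intro D hD
    simp only [Finset.mem_powersetCard] at hD
    have hD' : ∀ z ∈ D, k + 2 ≤ z ∧ z ≤ N := fun z hz => Finset.mem_Icc.1 (hD.1 hz)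
    ext z
    rw [Finset.mem_filter, Finset.mem_union, Finset.mem_Icc]
    constructor
    · rintro ⟨h | h, h'⟩
      · omega
      · exact h
    · intro h
      have := hD' _ h
      exact ⟨Or.inr h, by omega⟩

lemma Wf_u (u : Finset ℕ → ℚ[X]) (hu : ∀ S, conv Nf u S = delta S) (U : ℤ → ℚ[X])
    (hU : ∀ S, u S = U (S.card : ℤ)) (k N : ℕ) (hk : 1 ≤ k) :
    conv (Wf k 0) u (Finset.Icc 1 N) =
      - (X ^ k * ((N - (k + 1)).choose k : ℚ[X]) * U ((N : ℤ) - 2 * k)) := by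
  classical
  set S := Finset.Icc 1 N with hS
  have h0 : ∀ z ∈ S, 0 < z := by
    intro z hz; rw [hS, Finset.mem_Icc] at hz; omega
  have e1 : conv (Wf k 0) u S = X ^ k * ∑ x ∈ S, conv (cf k 0 x) (conv (Nh x) u) S := by
    rw [conv_congr (fun B hB => Wf_conv k 0 S B hB) (fun _ _ => rfl)]
    simp only [← conv_assoc]
    rw [conv, Finset.mul_sum]
    simp only [conv, Finset.mul_sum, Finset.sum_mul]
    rw [Finset.sum_comm (s := S)]
    apply Finset.sum_congr rfl
    intro A _
    apply Finset.sum_congr rfl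
    intro x _
    apply Finset.sum_congr rfl
    intro B _
    ring
  have e2 : ∀ x ∈ S, conv (cf k 0 x) (conv (Nh x) u) S = if x = k + 1 then
      - (((N - (k + 1)).choose k : ℚ[X]) * U ((N : ℤ) - 2 * k)) else 0 := by
    intro x hx
    have f1 : conv (cf k 0 x) (conv (Nh x) u) S = ∑ C ∈ S.powerset,
        if x ∉ C ∧ (C.filter (· < x)).card = k ∧ (C.filter (x < ·)).card = k ∧ ∀ z ∈ S \ C, x ≤ z
        then - U ((N : ℤ) - 2 * k) else 0 := by
      apply Finset.sum_congr rfl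
      intro C hC
      rw [Finset.mem_powerset] at hC
      rw [Nh_conv u hu]
      by_cases hxC : x ∈ C
      · rw [if_neg (show ¬ (x ∈ S \ C ∧ ∀ z ∈ S \ C, x ≤ z) from
          fun h => (Finset.mem_sdiff.1 h.1).2 hxC), if_neg (fun h => h.1 hxC), mul_zero]
      · rw [cf_eq k 0 x C (fun z hz => h0 z (hC hz)) (h0 x hx) hxC]
        by_cases g : (C.filter (· < x)).card = k ∧ (C.filter (x < ·)).card = k
        · have hcard : C.card = 2 * k := by
            have : C = C.filter (· < x) ∪ C.filter (x < ·) := by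
              ext z
              simp only [Finset.mem_union, Finset.mem_filter]
              constructor
              · intro hz
                rcases lt_trichotomy z x with h | rfl | h
                · exact Or.inl ⟨hz, h⟩
                · exact absurd hz hxC
                · exact Or.inr ⟨hz, h⟩
              · tauto
            rw [this, Finset.card_union_of_disjoint, g.1, g.2]
            · ring
            · rw [Finset.disjoint_filter]
              intro z _ h; omega
          have hc2 : ((S \ C).card : ℤ) = (N : ℤ) - 2 * k := by
            have h1 := Finset.card_sdiff_add_card_eq_card hC
            have h2 : S.card = N := by simp [hS]
            omega
          rw [hU, hc2]
          by_cases g2 : ∀ z ∈ S \ C, x ≤ z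
          · rw [if_pos g, if_pos (show x ∈ S \ C ∧ ∀ z ∈ S \ C, x ≤ z from ⟨Finset.mem_sdiff.2 ⟨hx, hxC⟩, g2⟩), if_pos ⟨hxC, g.1, g.2, g2⟩, one_mul]
          · rw [if_neg (show ¬ (x ∈ S \ C ∧ ∀ z ∈ S \ C, x ≤ z) from fun h => g2 h.2), mul_zero,
              if_neg (fun h => g2 h.2.2.2)]
        · rw [if_neg g, zero_mul, if_neg]
          tauto
    rw [f1]
    split_ifs with hxk
    · subst hxk
      rw [← Finset.sum_filter, Finset.sum_const, hS, count_C, nsmul_eq_mul]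
      · ring
      · rw [hS, Finset.mem_Icc] at hx; exact hx.2
    · apply Finset.sum_eq_zero
      intro C hC
      rw [if_neg]
      rintro ⟨g1, g2, g3, g4⟩
      apply hxk
      have : C.filter (· < x) = Finset.Icc 1 (x - 1) := by
        ext z
        rw [Finset.mem_filter, Finset.mem_Icc]
        rw [Finset.mem_powerset] at hC
        rw [hS, Finset.mem_Icc] at hx
        constructor
        · rintro ⟨a1, a2⟩
          have := h0 z (hC a1)
          omega
        · rintro ⟨a1, a2⟩
          refine ⟨?_, by omega⟩
          by_contra hz
          have := g4 z (by rw [Finset.mem_sdiff, hS, Finset.mem_Icc]; exact ⟨by omega, hz⟩)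
          omega
      rw [this] at g2
      simp at g2
      have := h0 x hx
      omega
  rw [e1, Finset.sum_congr rfl e2, Finset.sum_ite_eq']
  split_ifs with h
  · ring
  · rw [hS, Finset.mem_Icc] at h
    rw [show N - (k + 1) = 0 by omega, Nat.choose_eq_zero_of_lt (by omega)]
    simp

lemma redLmap (f : ℕ → ℕ) (l : List ℕ) (hf : ∀ x ∈ l, ∀ y ∈ l, x < y ↔ f x < f y) :
    wt (l.map f) = wt l := by
  have hT : ∀ l : List ℕ, (∀ x ∈ l, ∀ y ∈ l, x < y ↔ f x < f y) → (Tau (l.map f) ↔ Tau l) := by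
    intro l hf
    rcases l with _ | ⟨a, _ | ⟨b, _ | ⟨c, _ | ⟨d, _ | ⟨e, _ | ⟨g, t⟩⟩⟩⟩⟩⟩ <;> simp only [Tau, List.map_cons, List.map_nil]
    rw [hf a (by simp) c (by simp), hf c (by simp) e (by simp), hf e (by simp) g (by simp),
      hf g (by simp) d (by simp), hf d (by simp) b (by simp)]
  have hA : ∀ l : List ℕ, (∀ x ∈ l, ∀ y ∈ l, x < y ↔ f x < f y) → (Av (l.map f) ↔ Av l) := by
    intro l
    induction l with
    | nil => intro _; simp
    | cons a l ih =>
      intro hf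
      have h1 := hT _ hf
      rw [List.map_cons] at h1 ⊢
      rw [Av, Av, h1, ih (fun x hx y hy => hf x (by simp [hx]) y (by simp [hy]))]
  have hD : ∀ l : List ℕ, (∀ x ∈ l, ∀ y ∈ l, x < y ↔ f x < f y) → desL (l.map f) = desL l := by
    intro l
    induction l with
    | nil => intro _; simp
    | cons a l ih =>
      intro hf
      have h1 := ih (fun x hx y hy => hf x (by simp [hx]) y (by simp [hy]))
      rcases l with _ | ⟨b, l⟩
      · simp [desL_single]
      · simp only [List.map_cons] at h1 ⊢
        rw [desL_cons, desL_cons, h1]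
        simp only [hf b (by simp) a (by simp)]
  have hA' := hA l hf
  simp only [wt, hD l hf, List.map_eq_nil_iff]
  congr 1
  by_cases h : Av l
  · rw [if_pos h, if_pos (hA'.2 h)]
  · rw [if_neg h, if_neg (fun h' => h (hA'.1 h'))]

lemma Nf_map (S : Finset ℕ) (f : ℕ → ℕ) (hf : ∀ x ∈ S, ∀ y ∈ S, x < y ↔ f x < f y) :
    Nf (S.image f) = Nf S := by
  have hinj : Set.InjOn f S := by
    intro x hx y hy h
    have h1 := hf x hx y hy
    have h2 := hf y hy x hx
    omega
  obtain ⟨g, hg⟩ : ∃ g : ℕ → ℕ, ∀ x ∈ S, g (f x) = x :=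
    ⟨Function.invFunOn f S, fun x hx => hinj.leftInvOn_invFunOn hx⟩
  symm
  refine Finset.sum_bij' (fun l _ => l.map f) (fun l _ => l.map g) ?_ ?_ ?_ ?_ ?_
  · intro l hl
    have hl' := mem_of_LS hl
    rw [mem_LS] at hl ⊢
    constructor
    · exact List.Nodup.map_on (fun x hx y hy => hinj ((hl' x).1 hx) ((hl' y).1 hy)) hl.1
    · ext z; simp [hl']
  · intro l hl
    have hl' := mem_of_LS hl
    rw [mem_LS] at hl ⊢
    constructor
    · refine List.Nodup.map_on (fun x hx y hy => ?_) hl.1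
      rw [hl', Finset.mem_image] at hx hy
      obtain ⟨a, ha, rfl⟩ := hx
      obtain ⟨b, hb, rfl⟩ := hy
      rw [hg a ha, hg b hb]
      rintro rfl; rfl
    · ext z
      rw [List.mem_toFinset, List.mem_map]
      constructor
      · rintro ⟨x, hx, rfl⟩
        rw [hl', Finset.mem_image] at hx
        obtain ⟨a, ha, rfl⟩ := hx
        rwa [hg a ha]
      · intro hz
        exact ⟨f z, (hl' _).2 (Finset.mem_image_of_mem f hz), hg z hz⟩
  · intro l hl
    rw [List.map_map]
    conv_rhs => rw [← List.map_id l]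
    apply List.map_congr_left
    intro x hx
    exact hg x ((mem_of_LS hl x).1 hx)
  · intro l hl
    rw [List.map_map]
    conv_rhs => rw [← List.map_id l]
    apply List.map_congr_left
    intro x hx
    have := (mem_of_LS hl x).1 hx
    obtain ⟨a, ha, rfl⟩ := Finset.mem_image.1 this
    simp [hg a ha]
  · intro l hl
    rw [redLmap]
    intro x hx y hy
    exact hf x ((mem_of_LS hl x).1 hx) y ((mem_of_LS hl y).1 hy)

lemma Nf_card (S : Finset ℕ) : Nf S = Nf (Finset.Icc 1 S.card) := by
  have hlt : ∀ x ∈ S, ∀ y ∈ S, x < y → (S.filter (· ≤ x)).card < (S.filter (· ≤ y)).card := by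
    intro x hx y hy h
    apply Finset.card_lt_card
    rw [Finset.ssubset_iff_of_subset]
    · exact ⟨y, by simp [hy], by simp [h]⟩
    · intro z hz
      rw [Finset.mem_filter] at hz ⊢
      exact ⟨hz.1, by omega⟩
  have hf : ∀ x ∈ S, ∀ y ∈ S, x < y ↔ (S.filter (· ≤ x)).card < (S.filter (· ≤ y)).card := by
    intro x hx y hy
    refine ⟨hlt x hx y hy, fun h => ?_⟩
    by_contra hc
    rcases Nat.lt_or_ge y x with h1 | h1
    · have := hlt y hy x hx h1; omega
    · have : x = y := by omega
      subst this; omega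
  rw [← Nf_map S (fun x => (S.filter (· ≤ x)).card) hf]
  congr 1
  apply Finset.eq_of_subset_of_card_le
  · intro z hz
    obtain ⟨x, hx, rfl⟩ := Finset.mem_image.1 hz
    rw [Finset.mem_Icc]
    refine ⟨Finset.card_pos.2 ⟨x, by simp [hx]⟩, Finset.card_le_card (Finset.filter_subset _ _)⟩
  · rw [Finset.card_image_of_injOn]
    · simp
    · intro x hx y hy h
      have h1 := hf x hx y hy
      have h2 := hf y hy x hx
      simp only at h
      omega

lemma NMpoly_eq (n : ℕ) : NMpoly {[1, 6, 2, 5, 3, 4]} n = Nf (Finset.Icc 1 n) := by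
  rw [NMpoly]
  split_ifs with h
  · subst h
    simp [Nf, LS_empty, wt]
  · have hL : (List.range' 1 n).permutations.toFinset = LS (Finset.Icc 1 n) := by
      ext l
      rw [List.mem_toFinset, List.mem_permutations, mem_LS]
      have hr : (List.range' 1 n).toFinset = Finset.Icc 1 n := by
        ext z; simp [List.mem_range'_1]; omega
      constructor
      · intro hp
        exact ⟨hp.nodup_iff.2 List.nodup_range', by rw [List.toFinset_eq_of_perm _ _ hp, hr]⟩
      · rintro ⟨h1, h2⟩
        exact List.perm_of_nodup_nodup_toFinset_eq h1 List.nodup_range' (by rw [h2, hr])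
    rw [NMfinset, hL, Finset.sum_filter, Nf]
    apply Finset.sum_congr rfl
    intro l hl
    have hne : l ≠ [] := by
      rintro rfl
      have := length_of_LS hl
      simp at this
      omega
    have hm := hasMatch_iff l
    rw [wt, if_neg hne]
    by_cases ha : Av l
    · rw [if_pos ha, if_pos (hm.2 ha)]
    · rw [if_neg ha, if_neg (fun h => ha (hm.1 h))]

theorem stmt18 (Γ : Set (List ℕ)) (hΓ : Γ = {[1, 6, 2, 5, 3, 4]})
    (U : ℤ → Polynomial ℚ)
    (hUneg : ∀ m : ℤ, m < 0 → U m = 0)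
    (hU0 : U 0 = 1)
    (hUrec : ∀ n : ℕ, 1 ≤ n →
      ∑ k ∈ Finset.range (n + 1), (n.choose k : ℚ) • (U (k : ℤ) * NMpoly Γ (n - k)) = 0) :
    U 1 = -X ∧ ∀ n : ℕ, 2 ≤ n →
      U (n : ℤ) = (1 - X) * U ((n : ℤ) - 1) -
        (∑ k ∈ Finset.Icc 1 (n / 6),
          X ^ (3 * k - 1) * ((n - 3 * k - 1).choose (3 * k - 1) : Polynomial ℚ) *
            U ((n : ℤ) - 6 * k + 1)) +
        ∑ k ∈ Finset.Icc 1 ((n - 2) / 6),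
          X ^ (3 * k) * ((n - 3 * k - 2).choose (3 * k) : Polynomial ℚ) *
            U ((n : ℤ) - 6 * k - 1) := by
  subst hΓ
  obtain ⟨u, hu'⟩ : ∃ u : Finset ℕ → ℚ[X], ∀ S, u S = U (S.card : ℤ) := ⟨_, fun _ => rfl⟩
  have hu : ∀ S, conv Nf u S = delta S := by
    intro S
    rw [conv_comm]
    rcases S.eq_empty_or_nonempty with rfl | hne
    · simp [conv, delta, hu', hU0, Nf, LS_empty, wt]
    · rw [delta, if_neg hne.ne_empty, ← hUrec S.card (Finset.card_pos.2 hne)]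
      have := Finset.sum_powerset_apply_card
        (fun k => U (k : ℤ) * NMpoly {[1, 6, 2, 5, 3, 4]} (S.card - k)) (x := S)
      rw [conv]
      refine Eq.trans ?_ (this.trans ?_)
      · apply Finset.sum_congr rfl
        intro A hA
        rw [hu', Nf_card, NMpoly_eq, Finset.card_sdiff_of_subset (Finset.mem_powerset.1 hA)]
      · apply Finset.sum_congr rfl
        intro k _
        rw [← Nat.cast_smul_eq_nsmul ℚ]
  have hrec : ∀ N : ℕ, U ((N : ℤ) + 1) = (1 - X) * U N - (if N = 0 then 1 else 0)
      + conv (Ef 0 0) u (Finset.Icc 1 N) := by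
    intro N
    have h0 : ∀ x ∈ Finset.Icc 1 N, 0 < x := by
      intro x hx; rw [Finset.mem_Icc] at hx; omega
    have h := u_rec u hu 0 (Finset.Icc 1 N) h0
    rw [hu', hu', Finset.card_insert_of_notMem (notMem_of_lt h0), Nat.card_Icc, delta] at h
    have hc : (Finset.Icc 1 N = ∅) ↔ N = 0 := by
      rw [Finset.Icc_eq_empty_iff]; omega
    simp only [hc] at h
    push_cast at h
    simpa using h
  constructor
  · have h := hrec 0
    have h2 : conv (Ef 0 0) u (Finset.Icc 1 0) = 0 := by
      simp [conv, Ef_zero 0 0 ∅ (by simp)]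
    rw [h2] at h
    simp [hU0] at h
    rw [h]
  · intro n hn
    obtain ⟨N, rfl⟩ : ∃ N, n = N + 1 := ⟨n - 1, by omega⟩
    have h := hrec N
    rw [if_neg (by omega)] at h
    have hE : conv (Ef 0 0) u (Finset.Icc 1 N) = ∑ i ∈ Finset.range (N + 1),
        (conv (Wf (3 * i + 2) 0) u (Finset.Icc 1 N) - conv (Wf (3 * i + 3) 0) u (Finset.Icc 1 N)) := by
      simp only [conv]
      simp only [← Finset.sum_sub_distrib]
      rw [Finset.sum_comm]
      apply Finset.sum_congr rfl
      intro A hA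
      have hA' := Finset.card_le_card (Finset.mem_powerset.1 hA)
      rw [Nat.card_Icc] at hA'
      rw [Ef_sum 0 (N + 1) A, Ef_zero (3 * (N + 1)) 0 A (by omega), add_zero, Finset.sum_mul]
      apply Finset.sum_congr rfl
      intro i _
      ring
    have hshift : ∀ g : ℕ → ℚ[X], ∑ i ∈ Finset.range (N + 1), g (i + 1) =
        ∑ k ∈ Finset.Icc 1 (N + 1), g k := by
      intro g
      rw [Finset.range_eq_Ico, Finset.sum_Ico_add' g 0 (N + 1) 1]
      rfl
    have hW1 : ∑ i ∈ Finset.range (N + 1), conv (Wf (3 * i + 2) 0) u (Finset.Icc 1 N) =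
        - ∑ k ∈ Finset.Icc 1 ((N + 1) / 6),
          X ^ (3 * k - 1) * ((N + 1 - 3 * k - 1).choose (3 * k - 1) : ℚ[X]) *
            U (((N + 1 : ℕ) : ℤ) - 6 * k + 1) := by
      rw [Finset.sum_subset (Finset.Icc_subset_Icc_right (Nat.div_le_self (N + 1) 6)), ← hshift,
        ← Finset.sum_neg_distrib]
      · apply Finset.sum_congr rfl
        intro i _
        rw [Wf_u u hu U hu' _ _ (by omega)]
        congr 3
        · congr 2
          omega
        · push_cast; ring
      · intro k hk hk'
        rw [Finset.mem_Icc] at hk hk'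
        rw [Nat.choose_eq_zero_of_lt (by omega)]
        simp
    have hW2 : ∑ i ∈ Finset.range (N + 1), conv (Wf (3 * i + 3) 0) u (Finset.Icc 1 N) =
        - ∑ k ∈ Finset.Icc 1 ((N + 1 - 2) / 6),
          X ^ (3 * k) * ((N + 1 - 3 * k - 2).choose (3 * k) : ℚ[X]) *
            U (((N + 1 : ℕ) : ℤ) - 6 * k - 1) := by
      rw [Finset.sum_subset (Finset.Icc_subset_Icc_right
        (show (N + 1 - 2) / 6 ≤ N + 1 by omega)), ← hshift,
        ← Finset.sum_neg_distrib]
      · apply Finset.sum_congr rfl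
        intro i _
        rw [Wf_u u hu U hu' _ _ (by omega)]
        congr 3
        · congr 2
          omega
        · push_cast; ring
      · intro k hk hk'
        rw [Finset.mem_Icc] at hk hk'
        rw [Nat.choose_eq_zero_of_lt (by omega)]
        simp
    rw [hE, Finset.sum_sub_distrib, hW1, hW2] at h
    have e1 : (((N + 1 : ℕ) : ℤ)) = (N : ℤ) + 1 := by push_cast; ring
    have e2 : (((N + 1 : ℕ) : ℤ)) - 1 = (N : ℤ) := by push_cast; ring
    rw [e2, e1, h, e1]
    ring
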